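/- Let A and B be homogeneous sets, both uniformly disconnected. Then A and B are quasi-Lipschitz equivalent if and only if χ(A,B) = 0, i.e., if and only if lim_{r→0} α_A(r)/α_B(r) = 1. -/

import Mathlib

open scoped ENNReal

noncomputable section

open Filter MeasureTheory

/-- A compact set `A` is *homogeneous* with respect to the Borel probability measure `μ`
supported on `A` and constants `lam ≥ 1`, `kappa ∈ (0,1)`, `1 < del ≤ Del`. -/
structure IsHomog {X : Type*} [MetricSpace X] [MeasurableSpace X]
    (A : Set X) (μ : Measure X) (lam kappa del Del : ℝ) : Prop where
  compact : IsCompact A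
  diam_pos : 0 < Metric.diam A
  prob : IsProbabilityMeasure μ
  supp_null : μ Aᶜ = 0
  supp_pos : ∀ x ∈ A, ∀ r : ℝ, 0 < r → 0 < μ (Metric.closedBall x r)
  one_le_lam : 1 ≤ lam
  ratio_le : ∀ x₁ ∈ A, ∀ x₂ ∈ A, ∀ r : ℝ, 0 < r → r ≤ Metric.diam A →
    (μ (Metric.closedBall x₁ r)).toReal ≤ lam * (μ (Metric.closedBall x₂ r)).toReal
  kappa_pos : 0 < kappa
  kappa_lt_one : kappa < 1
  one_lt_del : 1 < del
  del_le_Del : del ≤ Del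
  scale_lower : ∀ x ∈ A, ∀ r : ℝ, 0 < r → r ≤ Metric.diam A →
    del * (μ (Metric.closedBall x (kappa * r))).toReal ≤ (μ (Metric.closedBall x r)).toReal
  scale_upper : ∀ x ∈ A, ∀ r : ℝ, 0 < r → r ≤ Metric.diam A →
    (μ (Metric.closedBall x r)).toReal ≤ Del * (μ (Metric.closedBall x (kappa * r))).toReal

/-- `alphaPt μ x r = log μ(B(x,r)) / log r`. -/
def alphaPt {X : Type*} [MetricSpace X] [MeasurableSpace X]
    (μ : Measure X) (x : X) (r : ℝ) : ℝ :=
  Real.log (μ (Metric.closedBall x r)).toReal / Real.log r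

/-- `g ∼ h` : `|h r - g r| = O(1/|log r|)` as `r → 0⁺`. -/
def EquivNearZero (g h : ℝ → ℝ) : Prop :=
  ∃ C : ℝ, 0 < C ∧ ∃ δ : ℝ, 0 < δ ∧ ∀ r : ℝ, 0 < r → r < δ → |h r - g r| ≤ C / |Real.log r|

/-- `g` is a representative of the equivalence class `[α_A(x,·)]` of the homogeneous set `A`. -/
def IsAlphaRep {X : Type*} [MetricSpace X] [MeasurableSpace X]
    (A : Set X) (μ : Measure X) (g : ℝ → ℝ) : Prop :=
  ∃ x ∈ A, EquivNearZero g (fun r => alphaPt μ x r)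

/-- `χ(A,B)` computed from representatives `g` of `[α_A]` and `h` of `[α_B]`. -/
def chiFun (g h : ℝ → ℝ) : ℝ :=
  Filter.limsup (fun r => |Real.log (g r / h r)|) (nhdsWithin (0 : ℝ) (Set.Ioi 0))

/-- `N(A,r)`: the smallest number of closed balls of radius `r` needed to cover `A`. -/
def coverNum {X : Type*} [MetricSpace X] (A : Set X) (r : ℝ) : ℕ :=
  sInf {m : ℕ | ∃ s : Finset X, s.card = m ∧ A ⊆ ⋃ x ∈ s, Metric.closedBall x r}

/-- Lower box-counting dimension. -/
def lowerBoxDim {X : Type*} [MetricSpace X] (A : Set X) : ℝ :=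
  Filter.liminf (fun r : ℝ => Real.log (coverNum A r : ℝ) / (-Real.log r))
    (nhdsWithin (0 : ℝ) (Set.Ioi 0))

/-- Upper box-counting dimension. -/
def upperBoxDim {X : Type*} [MetricSpace X] (A : Set X) : ℝ :=
  Filter.limsup (fun r : ℝ => Real.log (coverNum A r : ℝ) / (-Real.log r))
    (nhdsWithin (0 : ℝ) (Set.Ioi 0))

/-- Radius-based packing premeasure. -/
def packPre {X : Type*} [MetricSpace X] (A : Set X) (s : ℝ) : ℝ≥0∞ :=
  ⨅ (δ : ℝ) (_ : 0 < δ),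
    ⨆ (m : ℕ) (x : Fin m → X) (ρ : Fin m → ℝ) (_ : ∀ i, x i ∈ A)
      (_ : ∀ i, 0 < ρ i ∧ ρ i ≤ δ)
      (_ : ∀ i j, i ≠ j →
        Disjoint (Metric.closedBall (x i) (ρ i)) (Metric.closedBall (x j) (ρ j))),
      ∑ i, ENNReal.ofReal (ρ i ^ s)

/-- Radius-based packing measure. -/
def packMeasure {X : Type*} [MetricSpace X] (A : Set X) (s : ℝ) : ℝ≥0∞ :=
  ⨅ (F : ℕ → Set X) (_ : A ⊆ ⋃ m, F m), ∑' m, packPre (F m) s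

/-- Radius-based packing dimension. -/
def packDim {X : Type*} [MetricSpace X] (A : Set X) : ℝ :=
  sInf {s : ℝ | 0 ≤ s ∧ packMeasure A s = 0}

/-- Distance between two sets, valued in `ℝ≥0∞`. -/
def setDistE {X : Type*} [MetricSpace X] (E F : Set X) : ℝ≥0∞ :=
  ⨅ (a : X) (_ : a ∈ E) (b : X) (_ : b ∈ F), edist a b

/-- Uniformly disconnected set. -/
def UnifDisconn {X : Type*} [MetricSpace X] (A : Set X) : Prop :=
  ∃ C : ℝ, 1 < C ∧ ∃ rstar : ℝ, 0 < rstar ∧ ∀ x ∈ A, ∀ r : ℝ, 0 < r → r < rstar →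
    ∃ E : Set X, E ⊆ A ∧ A ∩ Metric.closedBall x r ⊆ E ∧
      E ⊆ Metric.closedBall x (C * r) ∧ ENNReal.ofReal r < setDistE E (A \ E)

/-- `A` can be bilipschitz embedded into `B`. -/
def BilipEmbed {X Y : Type*} [MetricSpace X] [MetricSpace Y] (A : Set X) (B : Set Y) : Prop :=
  ∃ (f : X → Y) (L : ℝ), 1 ≤ L ∧ Set.MapsTo f A B ∧ Set.InjOn f A ∧
    ∀ x₁ ∈ A, ∀ x₂ ∈ A,
      dist x₁ x₂ / L ≤ dist (f x₁) (f x₂) ∧ dist (f x₁) (f x₂) ≤ L * dist x₁ x₂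

/-- `A` and `B` are bilipschitz equivalent. -/
def BilipEquivSets {X Y : Type*} [MetricSpace X] [MetricSpace Y] (A : Set X) (B : Set Y) :
    Prop :=
  ∃ (f : X → Y) (L : ℝ), 1 ≤ L ∧ Set.BijOn f A B ∧
    ∀ x₁ ∈ A, ∀ x₂ ∈ A,
      dist x₁ x₂ / L ≤ dist (f x₁) (f x₂) ∧ dist (f x₁) (f x₂) ≤ L * dist x₁ x₂

/-- `A` and `B` are quasi-Lipschitz equivalent. -/
def QuasiLipEquiv {X Y : Type*} [MetricSpace X] [MetricSpace Y] (A : Set X) (B : Set Y) : Prop :=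
  ∃ f : X → Y, Set.BijOn f A B ∧
    ∀ ε : ℝ, 0 < ε → ∃ δ : ℝ, 0 < δ ∧ ∀ x₁ ∈ A, ∀ x₂ ∈ A,
      0 < dist x₁ x₂ → dist x₁ x₂ < δ →
      |Real.log (dist (f x₁) (f x₂)) / Real.log (dist x₁ x₂) - 1| < ε

/-- Ahlfors–David `s`-regular set. -/
def IsADRegular {X : Type*} [MetricSpace X] [MeasurableSpace X] (A : Set X) (s : ℝ) : Prop :=
  IsCompact A ∧ 0 < Metric.diam A ∧
    ∃ (μ : Measure X) (c : ℝ), 1 ≤ c ∧ μ Aᶜ = 0 ∧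
      ∀ x ∈ A, ∀ r : ℝ, 0 < r → r ≤ Metric.diam A →
        ENNReal.ofReal (c⁻¹ * r ^ s) ≤ μ (Metric.closedBall x r) ∧
          μ (Metric.closedBall x r) ≤ ENNReal.ofReal (c * r ^ s)

/-- `n₁ ⋯ n_k` (with `0`-based indexing of the sequence `n`). -/
def prodN (n : ℕ → ℕ) (k : ℕ) : ℕ := ∏ i ∈ Finset.range k, n i

/-- `c₁ ⋯ c_k` (with `0`-based indexing of the sequence `c`). -/
def prodC (c : ℕ → ℝ) (k : ℕ) : ℝ := ∏ i ∈ Finset.range k, c i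

/-- Admissible word for the branching sequence `n`. -/
def AdmWord (n : ℕ → ℕ) (w : List ℕ) : Prop := ∀ i : Fin w.length, w.get i < n i.val

/-- A Moran structure on `J ⊆ ℝ^d` with branching numbers `n` and ratios `c`:
`Jw w` is the basic set indexed by the word `w`. -/
structure IsMoranSystem {d : ℕ} (J : Set (EuclideanSpace ℝ (Fin d))) (n : ℕ → ℕ)
    (c : ℕ → ℝ) (Jw : List ℕ → Set (EuclideanSpace ℝ (Fin d))) : Prop where
  compact : IsCompact J
  int_nonempty : (interior J).Nonempty
  two_le_n : ∀ k, 2 ≤ n k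
  c_pos : ∀ k, 0 < c k
  c_lt_one : ∀ k, c k < 1
  c_inf_pos : ∃ c₀ : ℝ, 0 < c₀ ∧ ∀ k, c₀ ≤ c k
  root : Jw [] = J
  subset : ∀ w : List ℕ, AdmWord n w → ∀ i : ℕ, i < n w.length → Jw (w ++ [i]) ⊆ Jw w
  similar : ∀ w : List ℕ, AdmWord n w → ∀ i : ℕ, i < n w.length →
    ∃ S : EuclideanSpace ℝ (Fin d) → EuclideanSpace ℝ (Fin d),
      (∀ x y, dist (S x) (S y) = c w.length * dist x y) ∧ Jw (w ++ [i]) = S '' Jw w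
  disj_int : ∀ w : List ℕ, AdmWord n w → ∀ i : ℕ, i < n w.length → ∀ j : ℕ, j < n w.length →
    i ≠ j → Disjoint (interior (Jw (w ++ [i]))) (interior (Jw (w ++ [j])))

/-- The Moran set determined by the family `Jw`. -/
def moranSet {d : ℕ} (n : ℕ → ℕ) (Jw : List ℕ → Set (EuclideanSpace ℝ (Fin d))) :
    Set (EuclideanSpace ℝ (Fin d)) :=
  ⋂ k : ℕ, ⋃ (w : List ℕ) (_ : w.length = k ∧ AdmWord n w), Jw w

/-- The index `k` such that `(c₁⋯c_k)·D < r ≤ (c₁⋯c_{k-1})·D`. -/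
def levelOf (c : ℕ → ℝ) (D r : ℝ) : ℕ := sInf {k : ℕ | prodC c k * D < r}

/-- `Φ(r) = n₁⋯n_k` whenever `(c₁⋯c_k)·D < r ≤ (c₁⋯c_{k-1})·D`, where `D = |J|`. -/
def Phi (n : ℕ → ℕ) (c : ℕ → ℝ) (D r : ℝ) : ℕ := prodN n (levelOf c D r)

/-- A surjection between finite sets factors through any intermediate cardinality. -/
theorem exists_factor_through_card {α β : Type*} [Nonempty α] (S : Finset α) (p : α → β)
    [DecidableEq β] {n : ℕ} (h₁ : (S.image p).card ≤ n) (h₂ : n ≤ S.card) :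
    ∃ q : α → ℕ, q '' S = Set.Iio n ∧ ∀ s ∈ S, ∀ t ∈ S, q s = q t → p s = p t := by
  classical
  choose! sec hsecS hsec using fun (b : β) (hb : b ∈ S.image p) => Finset.mem_image.1 hb
  have hcard : ((S.image p).image sec).card = (S.image p).card := by
    refine Finset.card_image_of_injOn fun b hb c hc h => ?_
    rw [← hsec b hb, ← hsec c hc, h]
  have hsub : (S.image p).image sec ⊆ S := by
    intro s hs
    obtain ⟨b, hb, rfl⟩ := Finset.mem_image.1 hs
    exact hsecS b hb
  obtain ⟨U, hU₁, hU₂, hUn⟩ := Finset.exists_subsuperset_card_eq hsub (hcard ▸ h₁) h₂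
  let e : U ≃ Fin n := Finset.equivFinOfCardEq hUn
  have hsecU : ∀ s ∈ S, sec (p s) ∈ U := fun s hs =>
    hU₁ (Finset.mem_image_of_mem _ (Finset.mem_image_of_mem _ hs))
  let ret : α → α := fun s => if s ∈ U then s else sec (p s)
  have hretU : ∀ s ∈ S, ret s ∈ U := by
    intro s hs
    by_cases h : s ∈ U
    · simp [ret, h]
    · simpa [ret, h] using hsecU s hs
  have hpret : ∀ s ∈ S, p (ret s) = p s := by
    intro s hs
    by_cases h : s ∈ U
    · simp [ret, h]
    · simpa [ret, h] using hsec (p s) (Finset.mem_image_of_mem _ hs)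
  let q : α → ℕ := fun s => if h : ret s ∈ U then (e ⟨ret s, h⟩ : ℕ) else 0
  refine ⟨q, ?_, ?_⟩
  · ext i
    constructor
    · rintro ⟨s, hs, rfl⟩
      simp only [q, dif_pos (hretU s hs)]
      exact (e _).2
    · intro hi
      refine ⟨(e.symm ⟨i, hi⟩ : α), hU₂ (e.symm ⟨i, hi⟩).2, ?_⟩
      have h : ret (e.symm ⟨i, hi⟩ : α) = (e.symm ⟨i, hi⟩ : α) := by simp [ret]
      simp [q, h]
  · intro s hs t ht h
    simp only [q, dif_pos (hretU s hs), dif_pos (hretU t ht)] at h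
    have hret : ret s = ret t := by
      simpa using congrArg Subtype.val (e.injective (Fin.ext h))
    rw [← hpret s hs, ← hpret t ht, hret]

/-- A saturated set `F` lying in few `E₁`-classes, each splitting into many `E₂`-classes, admits
a labelling by exactly `n` labels which is coarser than `E₂` and finer than `E₁`. -/
theorem exists_labelling {T : Type*} [Nonempty T] {E₁ E₂ : Setoid T} [Finite (Quotient E₂)]
    (hE : E₂ ≤ E₁) {F : Set T} {n : ℕ}
    (h₁ : (Quotient.mk E₁ '' F).ncard ≤ n) (h₂ : n ≤ (Quotient.mk E₂ '' F).ncard) :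
    ∃ d : T → ℕ, d '' F = Set.Iio n ∧ (∀ x y, E₂ x y → d x = d y) ∧
      ∀ x ∈ F, ∀ y ∈ F, d x = d y → E₁ x y := by
  classical
  let p : Quotient E₂ → Quotient E₁ := Quotient.map' id hE
  have : Nonempty (Quotient E₂) := Nonempty.map (Quotient.mk E₂) ‹_›
  have hfin : (Quotient.mk E₂ '' F).Finite := Set.toFinite _
  have himg : ((hfin.toFinset.image p : Finset _) : Set (Quotient E₁)) = Quotient.mk E₁ '' F := by
    rw [Finset.coe_image, hfin.coe_toFinset, Set.image_image]
    rfl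
  obtain ⟨q, hq, hqp⟩ := exists_factor_through_card hfin.toFinset p (n := n)
    (by rwa [← Set.ncard_coe_finset, himg]) (by rwa [← Set.ncard_eq_toFinset_card _ hfin])
  rw [hfin.coe_toFinset] at hq
  refine ⟨fun x => q (Quotient.mk E₂ x), ?_, fun x y h => congrArg q (Quotient.sound h), ?_⟩
  · rw [← hq, Set.image_image]
  · intro x hx y hy h
    have := hqp _ (hfin.mem_toFinset.2 (Set.mem_image_of_mem _ hx)) _
      (hfin.mem_toFinset.2 (Set.mem_image_of_mem _ hy)) h
    exact Quotient.exact this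

/-- `c` codes the points of `T` at the resolution between `E₁` and `E₂`, using all codes below
`P`. -/
structure IsCode {T : Type*} (E₁ E₂ : Setoid T) (P : ℕ) (c : T → ℕ) : Prop where
  range_eq : Set.range c = Set.Iio P
  fine : ∀ x y, E₂ x y → c x = c y
  coarse : ∀ x y, c x = c y → E₁ x y

theorem IsCode.refine {T : Type*} {E₀ E₁ E₂ : Setoid T} {P n : ℕ} {c : T → ℕ}
    [Finite (Quotient E₁)] [Finite (Quotient E₂)] (hE : E₂ ≤ E₁) (hc : IsCode E₀ E₁ P c)
    (h₁ : ∀ x, (Quotient.mk E₁ '' {y | E₀ x y}).ncard ≤ n)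
    (h₂ : ∀ x, n ≤ (Quotient.mk E₂ '' {y | E₁ x y}).ncard) :
    ∃ c' : T → ℕ, IsCode E₁ E₂ (P * n) c' ∧ ∀ x, c' x / n = c x := by
  have key : ∀ v : ℕ, ∃ d : T → ℕ, v < P → d '' {x | c x = v} = Set.Iio n ∧
      (∀ x y, E₂ x y → d x = d y) ∧ ∀ x, c x = v → ∀ y, c y = v → d x = d y → E₁ x y := by
    intro v
    by_cases hv : v < P
    · obtain ⟨x, rfl⟩ : v ∈ Set.range c := hc.range_eq ▸ hv
      have : Nonempty T := ⟨x⟩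
      obtain ⟨d, hd⟩ := exists_labelling (F := {y | c y = c x}) hE
        ((Set.ncard_le_ncard (Set.image_mono fun y hy => hc.coarse x y (Eq.symm hy))
          (Set.toFinite _)).trans (h₁ x))
        ((h₂ x).trans (Set.ncard_le_ncard
          (Set.image_mono fun y hy => (hc.fine x y hy).symm) (Set.toFinite _)))
      exact ⟨d, fun _ => hd⟩
    · exact ⟨fun _ => 0, fun h => absurd h hv⟩
  choose d hd using key
  have hcP : ∀ x, c x < P := fun x => hc.range_eq.subset (Set.mem_range_self x)
  have hdn : ∀ x, d (c x) x < n := fun x =>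
    (hd _ (hcP x)).1.subset <| Set.mem_image_of_mem (d (c x)) (show x ∈ {y | c y = c x} from rfl)
  have hdiv : ∀ x, (c x * n + d (c x) x) / n = c x := fun x => by
    rw [mul_comm, Nat.mul_add_div ((Nat.zero_le _).trans_lt (hdn x)),
      Nat.div_eq_of_lt (hdn x), add_zero]
  refine ⟨fun x => c x * n + d (c x) x, ⟨?_, ?_, ?_⟩, hdiv⟩
  · ext w
    constructor
    · rintro ⟨x, rfl⟩
      have h₃ := hcP x
      have h₄ := hdn x
      simp only [Set.mem_Iio]
      nlinarith
    · intro hw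
      have hn : 0 < n := Nat.pos_of_ne_zero (by rintro rfl; simp at hw)
      have hv : w / n < P := Nat.div_lt_of_lt_mul (by rw [mul_comm]; exact hw)
      obtain ⟨x, hx, hxw⟩ : w % n ∈ d (w / n) '' {x | c x = w / n} :=
        (hd _ hv).1 ▸ Nat.mod_lt w hn
      have hx' : c x = w / n := hx
      refine ⟨x, ?_⟩
      simp only [hx', hxw]
      exact Nat.div_add_mod' w n
  · intro x y h
    have h' : c x = c y := hc.fine x y (hE h)
    simp only [h', (hd _ (hcP y)).2.1 x y h]
  · intro x y h
    have hxy : c x = c y := by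
      rw [← hdiv x, ← hdiv y]
      exact congrArg (· / n) h
    have hdxy : d (c y) x = d (c y) y := by
      simp only [hxy] at h
      omega
    exact (hd _ (hcP y)).2.2 x hxy y rfl hdxy

/-- A refining sequence of equivalence relations with compatible branching admits a coherent
sequence of codes. -/
theorem exists_codes {T : Type*} [Nonempty T] (E : ℕ → Setoid T)
    (hfin : ∀ k, Finite (Quotient (E k))) (hE : ∀ k, E (k + 1) ≤ E k) (h₀ : ∀ x y, E 0 x y)
    (n : ℕ → ℕ)
    (h₁ : ∀ k x, (Quotient.mk (E (k + 1)) '' {y | E k x y}).ncard ≤ n k)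
    (h₂ : ∀ k x, n k ≤ (Quotient.mk (E (k + 2)) '' {y | E (k + 1) x y}).ncard) :
    ∃ c : ℕ → T → ℕ, (∀ k, IsCode (E k) (E (k + 1)) (prodN n k) (c k)) ∧
      ∀ k x, c (k + 1) x / n k = c k x := by
  let C : ℕ → Type _ := fun k => {c : T → ℕ // IsCode (E k) (E (k + 1)) (prodN n k) c}
  have step : ∀ k (c : C k), ∃ c' : C (k + 1), ∀ x, c'.1 x / n k = c.1 x := by
    intro k c
    obtain ⟨c', hc', h⟩ := c.2.refine (hE (k + 1)) (h₁ k) (h₂ k)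
    refine ⟨⟨c', ?_⟩, h⟩
    rwa [prodN, Finset.prod_range_succ]
  choose next hnext using step
  let c : ∀ k, C k := Nat.rec
    ⟨fun _ => 0, by simp [prodN], fun _ _ _ => rfl, fun x y _ => h₀ x y⟩ next
  exact ⟨fun k => (c k).1, fun k => (c k).2, fun k x => hnext k (c k) x⟩

/-- In a compact space, every coherent sequence of codes is realised by a point. -/
theorem exists_point_of_codes {T : Type*} [TopologicalSpace T] [CompactSpace T] {n P : ℕ → ℕ}
    {c : ℕ → T → ℕ} (hrange : ∀ k, Set.range (c k) = Set.Iio (P k))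
    (hc : ∀ k x, c (k + 1) x / n k = c k x) (hclosed : ∀ k v, IsClosed {x | c k x = v})
    {v : ℕ → ℕ} (hvP : ∀ k, v k < P k) (hv : ∀ k, v (k + 1) / n k = v k) :
    ∃ x, ∀ k, c k x = v k := by
  obtain ⟨x, hx⟩ := IsCompact.nonempty_iInter_of_sequence_nonempty_isCompact_isClosed
    (fun k => {x | c k x = v k})
    (fun k x (hx : c (k + 1) x = v (k + 1)) => show c k x = v k by rw [← hc, hx, hv])
    (fun k => (hrange k).superset (hvP k)) (hclosed 0 _).isCompact (fun k => hclosed k _)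
  exact ⟨x, fun k => Set.mem_iInter.1 hx k⟩

/-- Two compact spaces coded by the same branching numbers are in code-preserving bijection. -/
theorem exists_equiv_of_codes {T S : Type*} [TopologicalSpace T] [CompactSpace T]
    [TopologicalSpace S] [CompactSpace S] {n P : ℕ → ℕ} {c : ℕ → T → ℕ} {c' : ℕ → S → ℕ}
    (hrange : ∀ k, Set.range (c k) = Set.Iio (P k))
    (hc : ∀ k x, c (k + 1) x / n k = c k x) (hclosed : ∀ k v, IsClosed {x | c k x = v})
    (hsep : ∀ x y, (∀ k, c k x = c k y) → x = y)
    (hrange' : ∀ k, Set.range (c' k) = Set.Iio (P k))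
    (hc' : ∀ k x, c' (k + 1) x / n k = c' k x) (hclosed' : ∀ k v, IsClosed {x | c' k x = v})
    (hsep' : ∀ x y, (∀ k, c' k x = c' k y) → x = y) :
    ∃ e : T ≃ S, ∀ k x, c' k (e x) = c k x := by
  choose f hf using fun x => exists_point_of_codes hrange' hc' hclosed'
    (v := fun k => c k x) (fun k => (hrange k).subset (Set.mem_range_self x)) (fun k => hc k x)
  choose g hg using fun y => exists_point_of_codes hrange hc hclosed
    (v := fun k => c' k y) (fun k => (hrange' k).subset (Set.mem_range_self y)) (fun k => hc' k y)
  exact ⟨⟨f, g, fun x => hsep _ _ fun k => by rw [hg, hf],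
    fun y => hsep' _ _ fun k => by rw [hf, hg]⟩, fun k x => hf x k⟩

/-- Two points are equivalent when they are joined by a chain with steps of length at most `r`. -/
def chainSetoid (T : Type*) [MetricSpace T] (r : ℝ) : Setoid T :=
  Relation.EqvGen.setoid fun x y => dist x y ≤ r

section Chain

variable {T : Type*} [MetricSpace T] {r s : ℝ}

theorem chainSetoid_of_dist_le {x y : T} (h : dist x y ≤ r) : chainSetoid T r x y :=
  Relation.EqvGen.rel x y h

theorem chainSetoid_mono (h : r ≤ s) : chainSetoid T r ≤ chainSetoid T s := fun x y hxy =>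
  Relation.EqvGen.mono (r := fun x y : T => dist x y ≤ r) (p := fun x y : T => dist x y ≤ s)
    (fun _ _ h' => le_trans h' h) x y hxy

theorem finite_quotient_chainSetoid [CompactSpace T] (hr : 0 < r) :
    Finite (Quotient (chainSetoid T r)) := by
  obtain ⟨t, -, ht, hcov⟩ := finite_cover_balls_of_compact (isCompact_univ (X := T)) hr
  have := ht.to_subtype
  refine Finite.of_surjective (fun x : t => Quotient.mk (chainSetoid T r) x) fun q => ?_
  induction q using Quotient.inductionOn with
  | h y =>
    obtain ⟨x, hx, hy⟩ := Set.mem_iUnion₂.1 (hcov (Set.mem_univ y))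
    refine ⟨⟨x, hx⟩, Quotient.sound (chainSetoid_of_dist_le ?_)⟩
    rw [dist_comm]
    exact (Metric.mem_ball.1 hy).le

theorem isClosed_setOf_eq_of_chainSetoid (hr : 0 < r) {c : T → ℕ}
    (hc : ∀ x y, chainSetoid T r x y → c x = c y) (v : ℕ) : IsClosed {x | c x = v} := by
  have : IsLocallyConstant c := by
    refine (IsLocallyConstant.iff_eventually_eq c).2 fun x => ?_
    filter_upwards [Metric.ball_mem_nhds x hr] with y hy
    exact hc y x (chainSetoid_of_dist_le (Metric.mem_ball.1 hy).le)
  exact this.isClosed_fiber v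

end Chain

/-- `ψ` vanishes at `u₀` and grows linearly, up to bounded errors. -/
structure LinearGrowth (ψ : ℝ → ℝ) (u₀ p q b : ℝ) : Prop where
  mono : Monotone ψ
  zero : ψ u₀ = 0
  p_pos : 0 < p
  q_nonneg : 0 ≤ q
  b_nonneg : 0 ≤ b
  lower : ∀ u v, u₀ ≤ u → u ≤ v → p * (v - u) - b ≤ ψ v - ψ u
  upper : ∀ u v, u ≤ v → ψ v - ψ u ≤ q * (v - u) + b

/-- A metric measure space in which balls of radius `exp (-u)` have measure comparable to
`exp (-ψ u)`, and which is uniformly disconnected. -/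
structure IsCellSpace (T : Type*) [MetricSpace T] [MeasurableSpace T] (m : Measure T)
    (ψ : ℝ → ℝ) (u₀ R K : ℝ) : Prop where
  prob : IsProbabilityMeasure m
  one_le_radius : 1 ≤ R
  one_le : 1 ≤ K
  ball_lower : ∀ x u, Real.exp (-ψ u) ≤ K * m.real (Metric.closedBall x (Real.exp (-u)))
  ball_upper : ∀ x u, m.real (Metric.closedBall x (R * Real.exp (-u))) ≤ K * Real.exp (-ψ u)
  chain : ∀ u x y, chainSetoid T (Real.exp (-u)) x y → dist x y ≤ R * Real.exp (-u)
  diam : ∀ x y : T, dist x y ≤ Real.exp (-u₀)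

namespace IsCellSpace

variable {T : Type*} [MetricSpace T] [MeasurableSpace T] [CompactSpace T]
  {m : Measure T} {ψ : ℝ → ℝ} {u₀ R K : ℝ}

/-- The number of fine cells meeting a set which contains the fine balls around its points. -/
theorem ncard_mul_le [BorelSpace T] (h : IsCellSpace T m ψ u₀ R K) {v : ℝ} {G : Set T}
    (hG : ∀ y ∈ G, Metric.closedBall y (Real.exp (-v)) ⊆ G) :
    ((Quotient.mk (chainSetoid T (Real.exp (-v))) '' G).ncard : ℝ) * Real.exp (-ψ v)
      ≤ K * m.real G := by
  classical
  have := h.prob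
  have := finite_quotient_chainSetoid (T := T) (Real.exp_pos (-v))
  have hfin : (Quotient.mk (chainSetoid T (Real.exp (-v))) '' G).Finite := Set.toFinite _
  have hex : ∀ w : Quotient (chainSetoid T (Real.exp (-v))),
      ∃ y, Quotient.mk _ y = w ∧
        (w ∈ Quotient.mk (chainSetoid T (Real.exp (-v))) '' G → y ∈ G) := by
    intro w
    by_cases hw : w ∈ Quotient.mk (chainSetoid T (Real.exp (-v))) '' G
    · obtain ⟨y, hy, rfl⟩ := hw
      exact ⟨y, rfl, fun _ => hy⟩
    · exact ⟨w.out, w.out_eq, fun h' => absurd h' hw⟩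
  choose y hyw hyG using hex
  have hdisj : Set.PairwiseDisjoint (hfin.toFinset : Set (Quotient _))
      fun w => Metric.closedBall (y w) (Real.exp (-v)) := by
    intro w _ w' _ hww'
    refine Set.disjoint_left.2 fun z hz hz' => hww' ?_
    rw [← hyw w, ← hyw w']
    refine Quotient.sound (Setoid.trans' _ (chainSetoid_of_dist_le ?_)
      (chainSetoid_of_dist_le (Metric.mem_closedBall.1 hz')))
    rw [dist_comm]
    exact Metric.mem_closedBall.1 hz
  have hsum := measureReal_biUnion_finset (μ := m) hdisj
    fun w _ => Metric.isClosed_closedBall.measurableSet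
  have hle : m.real (⋃ w ∈ hfin.toFinset, Metric.closedBall (y w) (Real.exp (-v))) ≤ m.real G :=
    measureReal_mono (Set.iUnion₂_subset fun w hw => hG _ (hyG w (hfin.mem_toFinset.1 hw)))
  rw [Set.ncard_eq_toFinset_card _ hfin, ← nsmul_eq_mul]
  calc _ ≤ ∑ w ∈ hfin.toFinset, K * m.real (Metric.closedBall (y w) (Real.exp (-v))) :=
        Finset.card_nsmul_le_sum _ _ _ fun w _ => h.ball_lower (y w) v
    _ = K * m.real (⋃ w ∈ hfin.toFinset, Metric.closedBall (y w) (Real.exp (-v))) := by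
        rw [hsum, Finset.mul_sum]
    _ ≤ K * m.real G := mul_le_mul_of_nonneg_left hle (zero_le_one.trans h.one_le)

theorem ncard_class_le [BorelSpace T] (h : IsCellSpace T m ψ u₀ R K) {u v : ℝ} (huv : u ≤ v)
    (x : T) :
    ((Quotient.mk (chainSetoid T (Real.exp (-v))) ''
      {y | chainSetoid T (Real.exp (-u)) x y}).ncard : ℝ) ≤ K ^ 2 * Real.exp (ψ v - ψ u) := by
  have := h.prob
  have hr : Real.exp (-v) ≤ Real.exp (-u) := Real.exp_le_exp.2 (neg_le_neg huv)
  have h₁ := h.ncard_mul_le (v := v) (G := {y | chainSetoid T (Real.exp (-u)) x y})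
    fun y hy z hz => Setoid.trans' _ hy (chainSetoid_of_dist_le
      ((dist_comm y z).trans_le ((Metric.mem_closedBall.1 hz).trans hr)))
  have h₂ : m.real {y | chainSetoid T (Real.exp (-u)) x y} ≤ K * Real.exp (-ψ u) :=
    (measureReal_mono fun y hy => Metric.mem_closedBall.2
      (h.chain u y x (Setoid.symm' _ hy))).trans (h.ball_upper x u)
  have h₃ := h₁.trans (mul_le_mul_of_nonneg_left h₂ (zero_le_one.trans h.one_le))
  rw [Real.exp_neg (ψ v), ← div_eq_mul_inv, div_le_iff₀ (Real.exp_pos _)] at h₃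
  refine h₃.trans_eq ?_
  rw [sub_eq_neg_add, Real.exp_add]
  ring

/-- Finitely many balls covering a set, counted by the fine cells it meets. -/
theorem measureReal_le_ncard_mul (h : IsCellSpace T m ψ u₀ R K) {v : ℝ} (G : Set T) :
    m.real G ≤ ((Quotient.mk (chainSetoid T (Real.exp (-v))) '' G).ncard : ℝ) *
      (K * Real.exp (-ψ v)) := by
  classical
  have := h.prob
  have := finite_quotient_chainSetoid (T := T) (Real.exp_pos (-v))
  have hfin : (Quotient.mk (chainSetoid T (Real.exp (-v))) '' G).Finite := Set.toFinite _
  have hcov : G ⊆ ⋃ w ∈ hfin.toFinset, Metric.closedBall w.out (R * Real.exp (-v)) :=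
    fun y hy => Set.mem_iUnion₂.2 ⟨Quotient.mk _ y, hfin.mem_toFinset.2 ⟨y, hy, rfl⟩,
      h.chain v _ _ (Setoid.symm' _ (Quotient.mk_out y))⟩
  rw [Set.ncard_eq_toFinset_card _ hfin, ← nsmul_eq_mul]
  exact (measureReal_mono hcov (measure_ne_top m _)).trans ((measureReal_biUnion_finset_le _ _).trans
    (Finset.sum_le_card_nsmul _ _ _ fun w _ => h.ball_upper _ v))

theorem le_ncard_class (h : IsCellSpace T m ψ u₀ R K) (u v : ℝ) (x : T) :
    Real.exp (ψ v - ψ u) ≤ K ^ 2 * ((Quotient.mk (chainSetoid T (Real.exp (-v))) ''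
      {y | chainSetoid T (Real.exp (-u)) x y}).ncard : ℝ) := by
  have := h.prob
  have h₁ := h.measureReal_le_ncard_mul (v := v) {y | chainSetoid T (Real.exp (-u)) x y}
  have h₂ : m.real (Metric.closedBall x (Real.exp (-u))) ≤
      m.real {y | chainSetoid T (Real.exp (-u)) x y} :=
    measureReal_mono fun y hy => chainSetoid_of_dist_le
      ((dist_comm x y).trans_le (Metric.mem_closedBall.1 hy))
  have h₃ := (h.ball_lower x u).trans
    (mul_le_mul_of_nonneg_left (h₂.trans h₁) (zero_le_one.trans h.one_le))
  rw [sub_eq_add_neg, Real.exp_add]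
  refine (mul_le_mul_of_nonneg_left h₃ (Real.exp_pos _).le).trans_eq ?_
  rw [Real.exp_neg (ψ v)]
  field_simp

end IsCellSpace

namespace LinearGrowth

variable {ψ : ℝ → ℝ} {u₀ p q b : ℝ}

/-- A function of linear growth takes every nonnegative value up to a bounded error. -/
theorem exists_between (h : LinearGrowth ψ u₀ p q b) {t : ℝ} (ht : 0 ≤ t) :
    ∃ u, u₀ ≤ u ∧ t ≤ ψ u ∧ ψ u ≤ t + (q + b) := by
  classical
  have hex : ∃ i : ℕ, t ≤ ψ (u₀ + i) := by
    obtain ⟨i, hi⟩ := exists_nat_ge ((t + b) / p)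
    refine ⟨i, ?_⟩
    have h₁ := h.lower u₀ (u₀ + i) le_rfl (by simp)
    rw [div_le_iff₀ h.p_pos] at hi
    rw [h.zero] at h₁
    nlinarith
  refine ⟨u₀ + Nat.find hex, by simp, Nat.find_spec hex, ?_⟩
  have hq := h.q_nonneg
  have hb := h.b_nonneg
  by_cases h₀ : Nat.find hex = 0
  · rw [h₀, Nat.cast_zero, add_zero, h.zero]
    linarith
  · obtain ⟨j, hj⟩ := Nat.exists_eq_succ_of_ne_zero h₀
    have h₁ := Nat.find_min hex (m := j) (by omega)
    have h₂ := h.upper (u₀ + j) (u₀ + (j + 1 : ℕ)) (by push_cast; linarith)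
    rw [hj]
    push_cast at h₂ ⊢
    push Not at h₁
    nlinarith

/-- Scales along which a function of linear growth is quadratic up to a bounded error. -/
theorem exists_quadratic_scales (h : LinearGrowth ψ u₀ p q b) {α : ℝ} (hα : 0 ≤ α) :
    ∃ U : ℕ → ℝ, U 0 = u₀ ∧ (∀ k, u₀ ≤ U k) ∧ (∀ k : ℕ, α * k ^ 2 ≤ ψ (U k)) ∧
      ∀ k : ℕ, ψ (U k) ≤ α * k ^ 2 + (q + b) := by
  have hq := h.q_nonneg
  have hb := h.b_nonneg
  choose U hU₀ hU₁ hU₂ using fun k : ℕ => h.exists_between (t := α * k ^ 2) (by positivity)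
  refine ⟨fun k => if k = 0 then u₀ else U k, by simp, fun k => ?_, fun k => ?_, fun k => ?_⟩ <;>
    by_cases hk : k = 0 <;> simp only [hk, if_true, if_false, hU₀, hU₁, hU₂, le_refl]
  · simp [h.zero]
  · rw [h.zero]
    push_cast
    linarith

end LinearGrowth

/-- A coherent sequence of codes whose levels have scales `U` along which `ψ` is quadratic. -/
structure IsQuadraticCoding (T : Type*) [MetricSpace T] (ψ : ℝ → ℝ) (R α β : ℝ) (n : ℕ → ℕ)
    (U : ℕ → ℝ) (c : ℕ → T → ℕ) : Prop where
  range_eq : ∀ k, Set.range (c k) = Set.Iio (prodN n k)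
  coherent : ∀ k x, c (k + 1) x / n k = c k x
  isClosed : ∀ k v, IsClosed {x | c k x = v}
  dist_le : ∀ k x y, c k x = c k y → dist x y ≤ R * Real.exp (-U k)
  lt_dist : ∀ k x y, c k x ≠ c k y → Real.exp (-U (k + 1)) < dist x y
  le_scale : ∀ k : ℕ, α * k ^ 2 ≤ ψ (U k)
  scale_le : ∀ k : ℕ, ψ (U k) ≤ α * k ^ 2 + β

theorem IsCellSpace.exists_coding {T : Type*} [MetricSpace T] [MeasurableSpace T] [BorelSpace T]
    [CompactSpace T] [Nonempty T] {m : Measure T} {ψ : ℝ → ℝ} {u₀ p q b R K α : ℝ}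
    (h : IsCellSpace T m ψ u₀ R K) (H : LinearGrowth ψ u₀ p q b)
    (hα : 2 * K ^ 2 * Real.exp (q + b) ≤ Real.exp α) :
    ∃ U c, IsQuadraticCoding T ψ R α (q + b) (fun k => ⌈Real.exp (α * (2 * k + 2))⌉₊) U c := by
  have hq := H.q_nonneg
  have hb := H.b_nonneg
  have hK : 1 ≤ K ^ 2 := one_le_pow₀ h.one_le
  have hαβ : q + b < α := by
    rw [← Real.exp_lt_exp]
    nlinarith [Real.exp_pos (q + b)]
  obtain ⟨U, hU₀, hUu, hU₁, hU₂⟩ := H.exists_quadratic_scales (α := α) (by linarith)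
  have hUmono : ∀ k, U k ≤ U (k + 1) := by
    intro k
    by_contra! hlt
    have h₁ := H.mono hlt.le
    have h₂ := hU₁ (k + 1)
    have h₃ := hU₂ k
    push_cast at h₂
    nlinarith [(Nat.cast_nonneg k : (0 : ℝ) ≤ k)]
  have hexp : ∀ k, Real.exp (-U (k + 1)) ≤ Real.exp (-U k) := fun k =>
    Real.exp_le_exp.2 (neg_le_neg (hUmono k))
  have hup : ∀ (k : ℕ) x, (Quotient.mk (chainSetoid T (Real.exp (-U (k + 1)))) ''
      {y | chainSetoid T (Real.exp (-U k)) x y}).ncard ≤ ⌈Real.exp (α * (2 * k + 2))⌉₊ := by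
    intro k x
    have h₁ := h.ncard_class_le (hUmono k) x
    rw [← Nat.cast_le (α := ℝ)]
    refine h₁.trans (le_trans ?_ (Nat.le_ceil _))
    have h₂ : ψ (U (k + 1)) - ψ (U k) ≤ α * (2 * k + 1) + (q + b) := by
      have := hU₁ k
      have := hU₂ (k + 1)
      push_cast at this
      linarith
    calc K ^ 2 * Real.exp (ψ (U (k + 1)) - ψ (U k))
        ≤ K ^ 2 * Real.exp (α * (2 * k + 1) + (q + b)) := by gcongr
      _ = K ^ 2 * Real.exp (q + b) * Real.exp (α * (2 * k + 1)) := by rw [Real.exp_add]; ring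
      _ ≤ Real.exp α * Real.exp (α * (2 * k + 1)) := by
        gcongr
        nlinarith [Real.exp_pos (q + b)]
      _ = Real.exp (α * (2 * k + 2)) := by rw [← Real.exp_add]; ring_nf
  have hlow : ∀ (k : ℕ) x, ⌈Real.exp (α * (2 * k + 2))⌉₊ ≤
      (Quotient.mk (chainSetoid T (Real.exp (-U (k + 2)))) ''
        {y | chainSetoid T (Real.exp (-U (k + 1))) x y}).ncard := by
    intro k x
    have h₁ := h.le_ncard_class (U (k + 1)) (U (k + 2)) x
    rw [← Nat.cast_le (α := ℝ)]
    have h₂ : α * (2 * k + 3) - (q + b) ≤ ψ (U (k + 2)) - ψ (U (k + 1)) := by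
      have := hU₁ (k + 2)
      have := hU₂ (k + 1)
      push_cast at *
      linarith
    have h₃ : (⌈Real.exp (α * (2 * k + 2))⌉₊ : ℝ) ≤ 2 * Real.exp (α * (2 * k + 2)) := by
      have h₄ := Nat.ceil_lt_add_one (Real.exp_pos (α * (2 * k + 2))).le
      have h₅ : 1 ≤ Real.exp (α * (2 * k + 2)) :=
        Real.one_le_exp (mul_nonneg (by linarith) (by positivity))
      linarith
    refine h₃.trans (le_of_mul_le_mul_left ?_ (show 0 < K ^ 2 by linarith))
    refine le_trans ?_ ((Real.exp_le_exp.2 h₂).trans h₁)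
    rw [show α * (2 * k + 3) - (q + b) = α * (2 * k + 2) + (α - (q + b)) by ring, Real.exp_add,
      Real.exp_sub]
    have h₆ : 2 * K ^ 2 ≤ Real.exp α / Real.exp (q + b) := by
      rwa [le_div_iff₀ (Real.exp_pos _)]
    nlinarith [Real.exp_pos (α * (2 * k + 2))]
  obtain ⟨c, hc, hcn⟩ := exists_codes (fun k => chainSetoid T (Real.exp (-U k)))
    (fun k => finite_quotient_chainSetoid (Real.exp_pos _)) (fun k => chainSetoid_mono (hexp k))
    (fun x y => chainSetoid_of_dist_le (hU₀ ▸ h.diam x y))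
    (fun k => ⌈Real.exp (α * (2 * k + 2))⌉₊) hup hlow
  exact ⟨U, c, fun k => (hc k).range_eq, hcn,
    fun k => isClosed_setOf_eq_of_chainSetoid (Real.exp_pos _) (hc k).fine,
    fun k x y hxy => h.chain _ _ _ ((hc k).coarse x y hxy),
    fun k x y hxy => lt_of_not_ge fun h' => hxy ((hc k).fine x y (chainSetoid_of_dist_le h')),
    hU₁, hU₂⟩

namespace IsQuadraticCoding

variable {T : Type*} [MetricSpace T] {ψ : ℝ → ℝ} {u₀ p q b R α β : ℝ} {n : ℕ → ℕ}
  {U : ℕ → ℝ} {c : ℕ → T → ℕ}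

theorem eq_of_forall_eq (h : IsQuadraticCoding T ψ R α β n U c) (hψ : Monotone ψ) (hR : 0 < R)
    (hα : 0 < α) {x y : T} (hxy : ∀ k, c k x = c k y) : x = y := by
  by_contra hne
  have hd : 0 < dist x y := dist_pos.2 hne
  obtain ⟨k, hk⟩ := exists_nat_gt (ψ (Real.log R - Real.log (dist x y)) / α)
  have h₁ : U k ≤ Real.log R - Real.log (dist x y) := by
    have h₂ := Real.log_le_log hd (h.dist_le k x y (hxy k))
    rw [Real.log_mul hR.ne' (Real.exp_pos _).ne', Real.log_exp] at h₂
    linarith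
  have h₂ := (h.le_scale k).trans (hψ h₁)
  have h₃ : ψ (Real.log R - Real.log (dist x y)) / α < k ^ 2 := by
    refine hk.trans_le ?_
    exact_mod_cast Nat.le_self_pow two_ne_zero k
  rw [div_lt_iff₀ hα] at h₃
  linarith

theorem exists_first_ne (h : IsQuadraticCoding T ψ R α β n U c) (hψ : Monotone ψ) (hR : 0 < R)
    (hα : 0 < α) {x y : T} (hne : x ≠ y) : ∃ k, c k x = c k y ∧ c (k + 1) x ≠ c (k + 1) y := by
  classical
  have hex : ∃ k, c k x ≠ c k y := by
    by_contra! hall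
    exact hne (h.eq_of_forall_eq hψ hR hα hall)
  have h₀ : c 0 x = c 0 y := by
    have hz : ∀ z, c 0 z = 0 := fun z => by
      simpa [prodN] using (h.range_eq 0).subset (Set.mem_range_self z)
    rw [hz, hz]
  have hpos : Nat.find hex ≠ 0 := fun h' => Nat.find_spec hex (h' ▸ h₀)
  obtain ⟨k, hk⟩ := Nat.exists_eq_succ_of_ne_zero hpos
  exact ⟨k, not_not.1 (Nat.find_min hex (by omega)),
    Eq.subst (motive := fun j => c j x ≠ c j y) hk (Nat.find_spec hex)⟩

/-- The level at which the codes of two points separate determines `ψ (-log (dist x y))`. -/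
theorem growth_bounds (h : IsQuadraticCoding T ψ R α β n U c) (H : LinearGrowth ψ u₀ p q b)
    (hR : 1 ≤ R) {x y : T} {k : ℕ} (h₁ : c k x = c k y) (h₂ : c (k + 1) x ≠ c (k + 1) y) :
    α * k ^ 2 - (q * Real.log R + b) ≤ ψ (-Real.log (dist x y)) ∧
      ψ (-Real.log (dist x y)) ≤ α * (k + 2) ^ 2 + β := by
  have hd : 0 < dist x y := (Real.exp_pos _).trans (h.lt_dist _ x y h₂)
  constructor
  · have h₃ := Real.log_le_log hd (h.dist_le k x y h₁)
    rw [Real.log_mul (by linarith) (Real.exp_pos _).ne', Real.log_exp] at h₃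
    have h₄ := H.upper (U k - Real.log R) (U k) (by linarith [Real.log_nonneg hR])
    have h₅ := H.mono (show U k - Real.log R ≤ -Real.log (dist x y) by linarith)
    have h₆ := h.le_scale k
    ring_nf at h₄ ⊢
    linarith
  · have h₃ := Real.log_le_log (Real.exp_pos _) (h.lt_dist _ x y h₂).le
    rw [Real.log_exp] at h₃
    have h₄ := H.mono (show -Real.log (dist x y) ≤ U (k + 1 + 1) by linarith)
    have h₅ := h.scale_le (k + 1 + 1)
    push_cast at h₅
    ring_nf at h₄ h₅ ⊢
    linarith

end IsQuadraticCoding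

/-- If two functions of linear growth are asymptotically close, then points at which they are
approximately the same square are asymptotically close. -/
theorem LinearGrowth.abs_sub_lt_of_quadratic {ψ ψ' : ℝ → ℝ} {u₀ p q b u₀' p' q' b' α C : ℝ}
    (H : LinearGrowth ψ u₀ p q b) (H' : LinearGrowth ψ' u₀' p' q' b')
    (hψ : (fun u => ψ u - ψ' u) =o[atTop] fun u => u) (hα : 0 < α) {ε : ℝ} (hε : 0 < ε) :
    ∀ᶠ u in atTop, ∀ u' ≥ u₀', ∀ s : ℝ, 0 ≤ s →
      α * s ^ 2 - C ≤ ψ u → ψ u ≤ α * (s + 2) ^ 2 + C →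
      α * s ^ 2 - C ≤ ψ' u' → ψ' u' ≤ α * (s + 2) ^ 2 + C → |u' - u| < ε * u := by
  have hp' := H'.p_pos
  have hq := H.q_nonneg
  set η : ℝ := ε * p' / 4 with hη
  have hη0 : 0 < η := by positivity
  set θ : ℝ := η / (q + 1) with hθ
  have hθ0 : 0 < θ := by positivity
  have hθq : θ * q ≤ η := by
    rw [hθ, div_mul_eq_mul_div, div_le_iff₀ (by positivity)]
    nlinarith
  set Z : ℝ := θ * (b + C - q * u₀) + 4 * α / θ + 4 * α + 2 * C + b' with hZ
  filter_upwards [hψ.def hη0, eventually_ge_atTop u₀, eventually_ge_atTop u₀',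
    eventually_gt_atTop 0, eventually_ge_atTop (Z / η)] with u h₁ hu hu' hu0 huZ
  intro u' hu'' s hs h₂ h₃ h₄ h₅
  rw [Real.norm_eq_abs, Real.norm_eq_abs, abs_of_pos hu0] at h₁
  rw [div_le_iff₀ hη0] at huZ
  have h₆ : α * s ^ 2 ≤ q * (u - u₀) + b + C := by
    have := H.upper u₀ u hu
    rw [H.zero] at this
    linarith
  have h₇ : 4 * α * s ≤ θ * (α * s ^ 2) + 4 * α / θ := by
    have : θ * (α * s ^ 2) + 4 * α / θ - 4 * α * s = α / θ * (θ * s - 2) ^ 2 := by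
      field_simp
      ring
    have h₈ : 0 ≤ α / θ * (θ * s - 2) ^ 2 := by positivity
    linarith
  have h₈ : θ * (α * s ^ 2) ≤ η * u + θ * (b + C - q * u₀) := by
    have := mul_le_mul_of_nonneg_left h₆ hθ0.le
    nlinarith
  obtain ⟨h₉, h₁₀⟩ := abs_le.1 h₁
  have hkey : |ψ' u' - ψ' u| + b' ≤ 3 * (η * u) := by
    have : |ψ' u' - ψ' u| ≤ 4 * α * s + 4 * α + 2 * C + η * u := by
      rw [abs_le]
      constructor <;> nlinarith
    linarith
  have hfin : p' * |u' - u| ≤ |ψ' u' - ψ' u| + b' := by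
    rcases le_total u u' with h | h
    · rw [abs_of_nonneg (sub_nonneg.2 h)]
      linarith [H'.lower u u' hu' h, le_abs_self (ψ' u' - ψ' u)]
    · rw [abs_of_nonpos (sub_nonpos.2 h)]
      linarith [H'.lower u' u hu'' h, neg_abs_le (ψ' u' - ψ' u)]
  have hlast : p' * |u' - u| < p' * (ε * u) := by
    have : p' * (ε * u) = 4 * (η * u) := by rw [hη]; ring
    have := mul_pos hη0 hu0
    linarith
  exact lt_of_mul_lt_mul_left hlast hp'.le

/-- Small distances are preserved up to a power close to `1`. -/
def IsQuasiLipMap {T S : Type*} [MetricSpace T] [MetricSpace S] (f : T → S) : Prop :=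
  ∀ ε : ℝ, 0 < ε → ∃ δ : ℝ, 0 < δ ∧ ∀ x y, 0 < dist x y → dist x y < δ →
    |Real.log (dist (f x) (f y)) / Real.log (dist x y) - 1| < ε

theorem IsCellSpace.exists_quasiLip_equiv {T S : Type*}
    [MetricSpace T] [MeasurableSpace T] [BorelSpace T] [CompactSpace T] [Nonempty T]
    [MetricSpace S] [MeasurableSpace S] [BorelSpace S] [CompactSpace S] [Nonempty S]
    {m : Measure T} {m' : Measure S} {ψ ψ' : ℝ → ℝ} {u₀ p q b R K u₀' p' q' b' R' K' : ℝ}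
    (h : IsCellSpace T m ψ u₀ R K) (H : LinearGrowth ψ u₀ p q b)
    (h' : IsCellSpace S m' ψ' u₀' R' K') (H' : LinearGrowth ψ' u₀' p' q' b')
    (hψ : (fun u => ψ u - ψ' u) =o[atTop] fun u => u) :
    ∃ e : T ≃ S, IsQuasiLipMap e := by
  obtain ⟨α, hα₁, hα₂, hα⟩ : ∃ α : ℝ, 2 * K ^ 2 * Real.exp (q + b) ≤ Real.exp α ∧
      2 * K' ^ 2 * Real.exp (q' + b') ≤ Real.exp α ∧ 0 < α :=
    ((Real.tendsto_exp_atTop.eventually_ge_atTop _).and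
      ((Real.tendsto_exp_atTop.eventually_ge_atTop _).and (eventually_gt_atTop 0))).exists
  have hR := zero_lt_one.trans_le h.one_le_radius
  have hR' := zero_lt_one.trans_le h'.one_le_radius
  obtain ⟨U, c, hc⟩ := h.exists_coding H hα₁
  obtain ⟨U', c', hc'⟩ := h'.exists_coding H' hα₂
  obtain ⟨e, he⟩ := exists_equiv_of_codes hc.range_eq hc.coherent hc.isClosed
    (fun x y => hc.eq_of_forall_eq H.mono hR hα) hc'.range_eq hc'.coherent hc'.isClosed
    (fun x y => hc'.eq_of_forall_eq H'.mono hR' hα)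
  refine ⟨e, fun ε hε => ?_⟩
  set C : ℝ := max (max (q * Real.log R + b) (q + b)) (max (q' * Real.log R' + b') (q' + b'))
    with hC
  obtain ⟨M, hM⟩ := eventually_atTop.1
    (H.abs_sub_lt_of_quadratic (C := C) H' hψ hα hε)
  refine ⟨Real.exp (-max M 1), Real.exp_pos _, fun x y hxy hlt => ?_⟩
  obtain ⟨k, hk₁, hk₂⟩ := hc.exists_first_ne H.mono hR hα (dist_pos.1 hxy)
  obtain ⟨hb₁, hb₂⟩ := hc.growth_bounds H h.one_le_radius hk₁ hk₂
  rw [← he, ← he] at hk₁ hk₂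
  obtain ⟨hb₃, hb₄⟩ := hc'.growth_bounds H' h'.one_le_radius hk₁ hk₂
  have hlog : max M 1 < -Real.log (dist x y) := by
    have := Real.log_lt_log hxy hlt
    rw [Real.log_exp] at this
    linarith
  have hu' : u₀' ≤ -Real.log (dist (e x) (e y)) := by
    have hpos : 0 < dist (e x) (e y) := dist_pos.2 (e.injective.ne (dist_pos.1 hxy))
    have := Real.log_le_log hpos (h'.diam (e x) (e y))
    rw [Real.log_exp] at this
    linarith
  have hC₁ : q * Real.log R + b ≤ C := (le_max_left _ _).trans (le_max_left _ _)
  have hC₂ : q + b ≤ C := (le_max_right _ _).trans (le_max_left _ _)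
  have hC₃ : q' * Real.log R' + b' ≤ C := (le_max_left _ _).trans (le_max_right _ _)
  have hC₄ : q' + b' ≤ C := (le_max_right _ _).trans (le_max_right _ _)
  have hfin := hM _ ((le_max_left _ _).trans hlog.le) _ hu' k k.cast_nonneg
    (by linarith) (by linarith) (by linarith) (by linarith)
  have hpos : 0 < -Real.log (dist x y) := by linarith [le_max_right M 1]
  rw [show Real.log (dist (e x) (e y)) / Real.log (dist x y) - 1 =
      (-Real.log (dist (e x) (e y)) - -Real.log (dist x y)) / -Real.log (dist x y) by
    have : Real.log (dist x y) ≠ 0 := by linarith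
    field_simp
    ring, abs_div, abs_of_pos hpos, div_lt_iff₀ hpos]
  exact hfin

namespace IsQuasiLipMap

variable {T S : Type*} [MetricSpace T] [MetricSpace S]

theorem log_dist_lt {f : T → S} (hf : IsQuasiLipMap f) {ε : ℝ} (hε : 0 < ε) :
    ∃ δ : ℝ, 0 < δ ∧ δ ≤ 1 ∧ ∀ x y, 0 < dist x y → dist x y < δ →
      Real.log (dist (f x) (f y)) < (1 - ε) * Real.log (dist x y) := by
  obtain ⟨δ, hδ, h⟩ := hf ε hε
  refine ⟨min δ 1, lt_min hδ one_pos, min_le_right _ _, fun x y h₁ h₂ => ?_⟩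
  have h₃ := (abs_lt.1 (h x y h₁ (h₂.trans_le (min_le_left _ _)))).1
  have h₄ := Real.log_neg h₁ (h₂.trans_le (min_le_right _ _))
  rwa [neg_lt_sub_iff_lt_add, ← sub_lt_iff_lt_add', lt_div_iff_of_neg h₄] at h₃

theorem continuous {f : T → S} (hf : IsQuasiLipMap f) : Continuous f := by
  obtain ⟨δ, hδ, -, h⟩ := hf.log_dist_lt (ε := 1 / 2) (by norm_num)
  refine Metric.continuous_iff.2 fun y η hη => ⟨min δ (η ^ 2), lt_min hδ (by positivity),
    fun x hx => ?_⟩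
  rcases dist_nonneg.eq_or_lt (a := (0 : ℝ)) (b := dist x y) with h₀ | h₀
  · rw [eq_of_dist_eq_zero h₀.symm, dist_self]
    exact hη
  rcases dist_nonneg.eq_or_lt (a := (0 : ℝ)) (b := dist (f x) (f y)) with h₁ | h₁
  · rwa [← h₁]
  rw [← Real.log_lt_log_iff h₁ hη]
  have h₂ := h x y h₀ (hx.trans_le (min_le_left _ _))
  have h₃ := Real.log_lt_log h₀ (hx.trans_le (min_le_right _ _))
  rw [Real.log_pow] at h₃
  push_cast at h₃
  linarith

theorem symm [CompactSpace T] [CompactSpace S] {e : T ≃ S} (he : IsQuasiLipMap e) :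
    IsQuasiLipMap e.symm := by
  have hunif : UniformContinuous e.symm :=
    CompactSpace.uniformContinuous_of_continuous
      (Continuous.homeoOfEquivCompactToT2 (f := e) he.continuous).symm.continuous
  intro ε hε
  obtain ⟨δ, hδ, h⟩ := he (min (1 / 2) (ε / 2)) (by positivity)
  obtain ⟨δ', hδ', h'⟩ := Metric.uniformContinuous_iff.1 hunif δ hδ
  refine ⟨δ', hδ', fun x y h₁ h₂ => ?_⟩
  have h₃ := h (e.symm x) (e.symm y) (dist_pos.2 (e.symm.injective.ne (dist_pos.1 h₁))) (h' h₂)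
  rw [e.apply_symm_apply, e.apply_symm_apply] at h₃
  rw [← inv_div]
  set t := Real.log (dist x y) / Real.log (dist (e.symm x) (e.symm y))
  obtain ⟨h₄, h₅⟩ := abs_lt.1 (h₃.trans_le (min_le_left _ _))
  have h₆ := h₃.trans_le (min_le_right _ _)
  have ht : 0 < t := by linarith
  rw [show t⁻¹ - 1 = (1 - t) / t by field_simp, abs_div, abs_of_pos ht, div_lt_iff₀ ht,
    abs_sub_comm]
  nlinarith

end IsQuasiLipMap

theorem IsCellSpace.sub_le_of_quasiLip {T S : Type*}
    [MetricSpace T] [MeasurableSpace T] [BorelSpace T] [CompactSpace T]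
    [MetricSpace S] [MeasurableSpace S]
    {m : Measure T} {m' : Measure S} {ψ ψ' : ℝ → ℝ} {u₀ R K u₀' p' q' b' R' K' : ℝ}
    (h : IsCellSpace T m ψ u₀ R K) (h' : IsCellSpace S m' ψ' u₀' R' K')
    (H' : LinearGrowth ψ' u₀' p' q' b') {f : T → S} (hsurj : Function.Surjective f)
    (hf : IsQuasiLipMap f) {η : ℝ} (hη : 0 < η) :
    ∀ᶠ u in atTop, ψ' u - ψ u ≤ η * u := by
  have := h.prob
  have := h'.prob
  have hq' := H'.q_nonneg
  have hK := zero_lt_one.trans_le h.one_le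
  have hK' := zero_lt_one.trans_le h'.one_le
  have hR := zero_lt_one.trans_le h.one_le_radius
  have hlogR := Real.log_nonneg h.one_le_radius
  set ε : ℝ := min (1 / 2) (η / (2 * (q' + 1))) with hε
  have hε0 : 0 < ε := by positivity
  have hε2 : ε ≤ 1 / 2 := min_le_left _ _
  have hεq : q' * ε ≤ η / 2 := by
    have h₁ : ε ≤ η / (2 * (q' + 1)) := min_le_right _ _
    rw [le_div_iff₀ (by positivity)] at h₁
    nlinarith
  obtain ⟨δ, hδ, hδ1, hlog⟩ := hf.log_dist_lt hε0
  set Z : ℝ := q' * Real.log R + b' + (Real.log K + Real.log K') with hZ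
  filter_upwards [eventually_gt_atTop (Real.log R - Real.log δ), eventually_gt_atTop (Real.log R),
    eventually_ge_atTop (Z / (η / 2)), eventually_ge_atTop 0] with u hu₁ hu₂ hu₃ hu₄
  set v : ℝ := (1 - ε) * (u - Real.log R) with hv
  have hsmall : R * Real.exp (-u) < δ := by
    rw [← Real.log_lt_log_iff (by positivity) hδ, Real.log_mul hR.ne' (Real.exp_pos _).ne',
      Real.log_exp]
    linarith
  have hball : ∀ x y, dist x y ≤ R * Real.exp (-u) → dist (f x) (f y) ≤ Real.exp (-v) := by
    intro x y hxy
    rcases dist_nonneg.eq_or_lt (a := (0 : ℝ)) (b := dist x y) with h₀ | h₀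
    · rw [eq_of_dist_eq_zero h₀.symm, dist_self]
      exact (Real.exp_pos _).le
    rcases dist_nonneg.eq_or_lt (a := (0 : ℝ)) (b := dist (f x) (f y)) with h₁ | h₁
    · rw [← h₁]
      exact (Real.exp_pos _).le
    rw [← Real.log_le_iff_le_exp h₁]
    have h₂ := hlog x y h₀ (hxy.trans_lt hsmall)
    have h₃ := Real.log_le_log h₀ hxy
    rw [Real.log_mul hR.ne' (Real.exp_pos _).ne', Real.log_exp] at h₃
    nlinarith
  classical
  have := finite_quotient_chainSetoid (T := T) (Real.exp_pos (-u))
  have := Fintype.ofFinite (Quotient (chainSetoid T (Real.exp (-u))))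
  have hcov : (Set.univ : Set S) ⊆ ⋃ w ∈ (Finset.univ : Finset (Quotient (chainSetoid T
      (Real.exp (-u))))), Metric.closedBall (f w.out) (R' * Real.exp (-v)) := by
    intro y _
    obtain ⟨x, rfl⟩ := hsurj y
    refine Set.mem_iUnion₂.2 ⟨Quotient.mk _ x, Finset.mem_univ _, ?_⟩
    refine (hball _ _ (h.chain u _ _ (Setoid.symm' _ (Quotient.mk_out x)))).trans ?_
    exact le_mul_of_one_le_left (Real.exp_pos _).le h'.one_le_radius
  have hcount₁ : 1 ≤ (Fintype.card (Quotient (chainSetoid T (Real.exp (-u)))) : ℝ) *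
      (K' * Real.exp (-ψ' v)) := by
    rw [← nsmul_eq_mul, ← probReal_univ (μ := m')]
    exact (measureReal_mono hcov (measure_ne_top m' _)).trans
      ((measureReal_biUnion_finset_le _ _).trans
        (Finset.sum_le_card_nsmul _ _ _ fun w _ => h'.ball_upper _ v))
  have hcount₂ : (Fintype.card (Quotient (chainSetoid T (Real.exp (-u)))) : ℝ) *
      Real.exp (-ψ u) ≤ K := by
    have h₁ := h.ncard_mul_le (v := u) (G := Set.univ) fun _ _ => Set.subset_univ _
    rwa [Set.image_univ, Set.range_eq_univ.2 Quotient.mk_surjective, Set.ncard_univ,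
      Nat.card_eq_fintype_card, probReal_univ, mul_one] at h₁
  have hkey : ψ' v - ψ u ≤ Real.log K + Real.log K' := by
    have h₁ : Real.exp (ψ' v - ψ u) ≤ K * K' := by
      rw [Real.exp_neg (ψ' v), ← mul_assoc, ← div_eq_mul_inv, le_div_iff₀ (Real.exp_pos _),
        one_mul] at hcount₁
      rw [sub_eq_add_neg, Real.exp_add]
      calc _ ≤ _ := mul_le_mul_of_nonneg_right hcount₁ (Real.exp_pos _).le
        _ ≤ _ := by
          rw [mul_right_comm]
          exact mul_le_mul_of_nonneg_right hcount₂ hK'.le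
    rw [← Real.log_mul hK.ne' hK'.ne']
    exact (Real.le_log_iff_exp_le (by positivity)).2 h₁
  have hvu : v ≤ u := by nlinarith
  have h₁ := H'.upper v u hvu
  have h₂ : q' * (u - v) ≤ η / 2 * u + q' * Real.log R := by
    have h₃ : u - v ≤ ε * u + Real.log R := by rw [hv]; nlinarith
    have h₄ := mul_le_mul_of_nonneg_left h₃ hq'
    have h₅ := mul_le_mul_of_nonneg_right hεq hu₄
    linarith
  rw [div_le_iff₀ (by positivity)] at hu₃
  linarith

theorem IsCellSpace.isLittleO_of_quasiLip {T S : Type*}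
    [MetricSpace T] [MeasurableSpace T] [BorelSpace T] [CompactSpace T]
    [MetricSpace S] [MeasurableSpace S] [BorelSpace S] [CompactSpace S]
    {m : Measure T} {m' : Measure S} {ψ ψ' : ℝ → ℝ} {u₀ p q b R K u₀' p' q' b' R' K' : ℝ}
    (h : IsCellSpace T m ψ u₀ R K) (H : LinearGrowth ψ u₀ p q b)
    (h' : IsCellSpace S m' ψ' u₀' R' K') (H' : LinearGrowth ψ' u₀' p' q' b')
    {e : T ≃ S} (he : IsQuasiLipMap e) :
    (fun u => ψ u - ψ' u) =o[atTop] fun u => u := by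
  refine Asymptotics.isLittleO_iff.2 fun η hη => ?_
  filter_upwards [h.sub_le_of_quasiLip h' H' e.surjective he hη,
    h'.sub_le_of_quasiLip h H e.symm.surjective he.symm hη, eventually_ge_atTop 0] with u h₁ h₂ h₃
  rw [Real.norm_eq_abs, Real.norm_eq_abs, abs_of_nonneg h₃, abs_le]
  constructor <;> linarith

theorem linearGrowth_of_step {ψ : ℝ → ℝ} {u₀ L s t : ℝ} (hmono : Monotone ψ) (hzero : ψ u₀ = 0)
    (hL : 0 < L) (hs : 0 < s) (hlow : ∀ u, u₀ ≤ u → ψ u + s ≤ ψ (u + L))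
    (hup : ∀ u, ψ (u + L) ≤ ψ u + t) : LinearGrowth ψ u₀ (s / L) (t / L) t := by
  have hst : s ≤ t := by linarith [hlow u₀ le_rfl, hup u₀]
  have hlow' : ∀ u, u₀ ≤ u → ∀ n : ℕ, ψ u + n * s ≤ ψ (u + n * L) := by
    intro u hu n
    induction n with
    | zero => simp
    | succ n ih =>
      have := hlow (u + n * L) (hu.trans (le_add_of_nonneg_right (by positivity)))
      push_cast
      rw [show u + (n + 1) * L = u + n * L + L by ring]
      linarith
  have hup' : ∀ u, ∀ n : ℕ, ψ (u + n * L) ≤ ψ u + n * t := by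
    intro u n
    induction n with
    | zero => simp
    | succ n ih =>
      have := hup (u + n * L)
      push_cast
      rw [show u + (n + 1) * L = u + n * L + L by ring]
      linarith
  refine ⟨hmono, hzero, by positivity, div_nonneg (hs.le.trans hst) hL.le, hs.le.trans hst,
    fun u v hu huv => ?_, fun u v huv => ?_⟩
  · have hn : (⌊(v - u) / L⌋₊ : ℝ) * L ≤ v - u := by
      rw [← le_div_iff₀ hL]
      exact Nat.floor_le (div_nonneg (sub_nonneg.2 huv) hL.le)
    have hn' := Nat.lt_floor_add_one ((v - u) / L)
    have h₁ := hlow' u hu ⌊(v - u) / L⌋₊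
    have h₂ := hmono (show u + ⌊(v - u) / L⌋₊ * L ≤ v by linarith)
    have h₃ : s / L * (v - u) = s * ((v - u) / L) := by ring
    rw [h₃]
    nlinarith
  · have hn : v - u ≤ (⌈(v - u) / L⌉₊ : ℝ) * L := by
      rw [← div_le_iff₀ hL]
      exact Nat.le_ceil _
    have hn' := Nat.ceil_lt_add_one (div_nonneg (sub_nonneg.2 huv) hL.le)
    have h₁ := hup' u ⌈(v - u) / L⌉₊
    have h₂ := hmono (show v ≤ u + ⌈(v - u) / L⌉₊ * L by linarith)
    have h₃ : t / L * (v - u) = t * ((v - u) / L) := by ring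
    rw [h₃]
    nlinarith

/-- The logarithmic measure growth `u ↦ -log (μ (closedBall x (exp (-u))))` at a point. -/
def logGrowth {X : Type*} [MetricSpace X] [MeasurableSpace X] (μ : Measure X) (x : X) (u : ℝ) :
    ℝ :=
  -Real.log (μ.real (Metric.closedBall x (Real.exp (-u))))

theorem alphaPt_exp_neg {X : Type*} [MetricSpace X] [MeasurableSpace X] (μ : Measure X) (x : X)
    (u : ℝ) : alphaPt μ x (Real.exp (-u)) = logGrowth μ x u / u := by
  rw [alphaPt, logGrowth, Real.log_exp, div_neg, neg_div, measureReal_def]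

theorem UnifDisconn.dist_le_of_chainSetoid {X : Type*} [MetricSpace X] {A : Set X}
    (hA : IsCompact A) (hud : UnifDisconn A) :
    ∃ R : ℝ, 1 ≤ R ∧ ∀ r : ℝ, 0 < r → ∀ x y : A, chainSetoid A r x y → dist x y ≤ R * r := by
  obtain ⟨C, hC, rs, hrs, h⟩ := hud
  refine ⟨max C (Metric.diam A / rs), hC.le.trans (le_max_left _ _), fun r hr x y hxy => ?_⟩
  rcases lt_or_ge r rs with hlt | hge
  · obtain ⟨E, -, hballE, hEball, hdist⟩ := h x x.2 r hr hlt
    have hstep : ∀ a b : A, dist a b ≤ r → a.1 ∈ E → b.1 ∈ E := by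
      intro a b hab ha
      by_contra hb
      refine hdist.not_ge ((iInf₂_le_of_le a.1 ha (iInf₂_le b.1 ⟨b.2, hb⟩)).trans ?_)
      rw [edist_dist]
      exact ENNReal.ofReal_le_ofReal hab
    have hinv : ∀ a b : A, Relation.EqvGen (fun a b : A => dist a b ≤ r) a b →
        (a.1 ∈ E ↔ b.1 ∈ E) := by
      intro a b hab
      induction hab with
      | rel a b hab => exact ⟨hstep a b hab, hstep b a ((dist_comm b a).trans_le hab)⟩
      | refl a => exact Iff.rfl
      | symm a b _ ih => exact ih.symm
      | trans a b c _ _ ih₁ ih₂ => exact ih₁.trans ih₂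
    have hx : x.1 ∈ E := hballE ⟨x.2, Metric.mem_closedBall_self hr.le⟩
    have hy := Metric.mem_closedBall.1 (hEball ((hinv x y hxy).1 hx))
    rw [dist_comm]
    exact hy.trans (mul_le_mul_of_nonneg_right (le_max_left _ _) hr.le)
  · calc dist x y ≤ Metric.diam A := Metric.dist_le_diam_of_mem hA.isBounded x.2 y.2
      _ = Metric.diam A / rs * rs := by field_simp
      _ ≤ Metric.diam A / rs * r := by gcongr
      _ ≤ _ := mul_le_mul_of_nonneg_right (le_max_right _ _) hr.le

namespace IsHomog

variable {X : Type*} [MetricSpace X] [MeasurableSpace X]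
  {A : Set X} {μ : Measure X} {lam kappa del Del : ℝ}

theorem real_closedBall_pos (h : IsHomog A μ lam kappa del Del) {x : X} (hx : x ∈ A) {r : ℝ}
    (hr : 0 < r) : 0 < μ.real (Metric.closedBall x r) := by
  have := h.prob
  exact ENNReal.toReal_pos (h.supp_pos x hx r hr).ne' (measure_ne_top μ _)

theorem real_closedBall_eq_one (h : IsHomog A μ lam kappa del Del) {x : X} (hx : x ∈ A)
    {r : ℝ} (hr : Metric.diam A ≤ r) : μ.real (Metric.closedBall x r) = 1 := by
  have := h.prob
  have hnull : μ (Metric.closedBall x r)ᶜ = 0 :=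
    measure_mono_null (Set.compl_subset_compl.2 fun y hy => Metric.mem_closedBall.2
      ((Metric.dist_le_diam_of_mem h.compact.isBounded hy hx).trans hr)) h.supp_null
  rw [measureReal_def, measure_of_measure_compl_eq_zero hnull, measure_univ, ENNReal.toReal_one]

theorem ratio_le' (h : IsHomog A μ lam kappa del Del) {x y : X} (hx : x ∈ A) (hy : y ∈ A)
    {r : ℝ} (hr : 0 < r) :
    μ.real (Metric.closedBall x r) ≤ lam * μ.real (Metric.closedBall y r) := by
  rcases le_total r (Metric.diam A) with hle | hle
  · exact h.ratio_le x hx y hy r hr hle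
  · rw [h.real_closedBall_eq_one hx hle, h.real_closedBall_eq_one hy hle, mul_one]
    exact h.one_le_lam

theorem scale_upper' (h : IsHomog A μ lam kappa del Del) {x : X} (hx : x ∈ A) {r : ℝ}
    (hr : 0 < r) :
    μ.real (Metric.closedBall x r) ≤ Del * μ.real (Metric.closedBall x (kappa * r)) := by
  have := h.prob
  rcases le_total r (Metric.diam A) with hle | hle
  · exact h.scale_upper x hx r hr hle
  · have h₁ := h.scale_upper x hx _ h.diam_pos le_rfl
    rw [← measureReal_def, ← measureReal_def, h.real_closedBall_eq_one hx le_rfl] at h₁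
    rw [h.real_closedBall_eq_one hx hle]
    have hDel : 0 ≤ Del := by linarith [h.one_lt_del, h.del_le_Del]
    exact h₁.trans (mul_le_mul_of_nonneg_left (measureReal_mono
      (Metric.closedBall_subset_closedBall (mul_le_mul_of_nonneg_left hle h.kappa_pos.le))) hDel)

theorem linearGrowth (h : IsHomog A μ lam kappa del Del) {x : X} (hx : x ∈ A) :
    ∃ p q b : ℝ, LinearGrowth (logGrowth μ x) (-Real.log (Metric.diam A)) p q b := by
  have := h.prob
  have hdel : 0 < del := zero_lt_one.trans h.one_lt_del
  have hDel : 0 < Del := hdel.trans_le h.del_le_Del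
  have hpos : ∀ u, 0 < μ.real (Metric.closedBall x (Real.exp (-u))) := fun u =>
    h.real_closedBall_pos hx (Real.exp_pos _)
  have hexp : ∀ u, Real.exp (-(u + -Real.log kappa)) = kappa * Real.exp (-u) := fun u => by
    rw [neg_add, neg_neg, Real.exp_add, Real.exp_log h.kappa_pos, mul_comm]
  refine ⟨_, _, _, linearGrowth_of_step (L := -Real.log kappa) (s := Real.log del)
    (t := Real.log Del) ?_ ?_ (neg_pos.2 (Real.log_neg h.kappa_pos h.kappa_lt_one))
    (Real.log_pos h.one_lt_del) ?_ ?_⟩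
  · intro u v huv
    exact neg_le_neg (Real.log_le_log (hpos v) (measureReal_mono
      (Metric.closedBall_subset_closedBall (Real.exp_le_exp.2 (neg_le_neg huv)))))
  · rw [logGrowth, neg_neg, Real.exp_log h.diam_pos, h.real_closedBall_eq_one hx le_rfl,
      Real.log_one, neg_zero]
  · intro u hu
    have hr : Real.exp (-u) ≤ Metric.diam A := by
      rw [← Real.le_log_iff_exp_le h.diam_pos]
      linarith
    have h₁ := Real.log_le_log (mul_pos hdel (hexp u ▸ hpos (u + -Real.log kappa)))
      (h.scale_lower x hx _ (Real.exp_pos _) hr)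
    rw [Real.log_mul hdel.ne' (hexp u ▸ hpos (u + -Real.log kappa)).ne', ← hexp] at h₁
    simp only [logGrowth, measureReal_def]
    linarith
  · intro u
    have h₁ := Real.log_le_log (hpos u) (h.scale_upper' hx (Real.exp_pos _))
    rw [← hexp, Real.log_mul hDel.ne' (hpos _).ne'] at h₁
    simp only [logGrowth]
    linarith

theorem comap_real_closedBall [BorelSpace X] (h : IsHomog A μ lam kappa del Del) (x : A) (r : ℝ) :
    (μ.comap (Subtype.val : A → X)).real (Metric.closedBall x r) =
      μ.real (Metric.closedBall x.1 r) := by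
  have hA : MeasurableSet A := h.compact.isClosed.measurableSet
  have himg : Subtype.val '' Metric.closedBall x r = Metric.closedBall x.1 r ∩ A := by
    ext y
    constructor
    · rintro ⟨z, hz, rfl⟩
      exact ⟨hz, z.2⟩
    · rintro ⟨hy, hyA⟩
      exact ⟨⟨y, hyA⟩, hy, rfl⟩
  rw [measureReal_def, measureReal_def, (MeasurableEmbedding.subtype_coe hA).comap_apply, himg,
    measure_inter_conull h.supp_null]

theorem isCellSpace [BorelSpace X] (h : IsHomog A μ lam kappa del Del) (hud : UnifDisconn A)
    {x : X} (hx : x ∈ A) :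
    ∃ R K : ℝ, IsCellSpace A (μ.comap Subtype.val) (logGrowth μ x)
      (-Real.log (Metric.diam A)) R K := by
  have := h.prob
  obtain ⟨p, q, b, H⟩ := h.linearGrowth hx
  obtain ⟨R, hR, hchain⟩ := hud.dist_le_of_chainSetoid h.compact
  have hexp : ∀ u, Real.exp (-logGrowth μ x u) = μ.real (Metric.closedBall x (Real.exp (-u))) :=
    fun u => by
      rw [logGrowth, neg_neg, Real.exp_log (h.real_closedBall_pos hx (Real.exp_pos _))]
  have hlam := zero_lt_one.trans_le h.one_le_lam
  have hexp1 : 1 ≤ Real.exp (q * Real.log R + b) := Real.one_le_exp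
    (add_nonneg (mul_nonneg H.q_nonneg (Real.log_nonneg hR)) H.b_nonneg)
  refine ⟨R, lam * Real.exp (q * Real.log R + b), ⟨?_⟩, hR,
    one_le_mul_of_one_le_of_one_le h.one_le_lam hexp1, fun y u => ?_, fun y u => ?_,
    fun u y z => hchain _ (Real.exp_pos _) y z, fun y z => ?_⟩
  · rw [(MeasurableEmbedding.subtype_coe h.compact.isClosed.measurableSet).comap_apply,
      Set.image_univ, Subtype.range_coe, measure_of_measure_compl_eq_zero h.supp_null,
      measure_univ]
  · rw [hexp, h.comap_real_closedBall]
    refine (h.ratio_le' hx y.2 (Real.exp_pos _)).trans ?_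
    exact mul_le_mul_of_nonneg_right (le_mul_of_one_le_right hlam.le hexp1) measureReal_nonneg
  · have h₁ : R * Real.exp (-u) = Real.exp (-(u - Real.log R)) := by
      rw [neg_sub, sub_eq_add_neg, Real.exp_add, Real.exp_log (zero_lt_one.trans_le hR)]
    have h₂ := H.upper (u - Real.log R) u (by linarith [Real.log_nonneg hR])
    rw [h.comap_real_closedBall, h₁, mul_assoc, ← Real.exp_add]
    refine (h.ratio_le' y.2 hx (Real.exp_pos _)).trans (mul_le_mul_of_nonneg_left ?_ hlam.le)
    rw [← hexp]
    refine Real.exp_le_exp.2 ?_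
    ring_nf at h₂ ⊢
    linarith
  · rw [neg_neg, Real.exp_log h.diam_pos]
    exact Metric.dist_le_diam_of_mem h.compact.isBounded y.2 z.2

end IsHomog

theorem quasiLipEquiv_iff {X Y : Type*} [MetricSpace X] [MetricSpace Y] {A : Set X} {B : Set Y}
    (hB : B.Nonempty) : QuasiLipEquiv A B ↔ ∃ e : A ≃ B, IsQuasiLipMap e := by
  constructor
  · rintro ⟨f, hf, h⟩
    refine ⟨hf.equiv f, fun ε hε => ?_⟩
    obtain ⟨δ, hδ, h⟩ := h ε hε
    exact ⟨δ, hδ, fun x y => h x x.2 y y.2⟩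
  · rintro ⟨e, h⟩
    classical
    obtain ⟨y₀, -⟩ := hB
    have hf : ∀ x : A, (fun x => if hx : x ∈ A then (e ⟨x, hx⟩ : Y) else y₀) x.1 = e x :=
      fun x => dif_pos x.2
    refine ⟨fun x => if hx : x ∈ A then (e ⟨x, hx⟩ : Y) else y₀, ⟨?_, ?_, ?_⟩, fun ε hε => ?_⟩
    · intro x hx
      rw [hf ⟨x, hx⟩]
      exact (e _).2
    · intro x hx y hy hxy
      rw [hf ⟨x, hx⟩, hf ⟨y, hy⟩] at hxy
      exact congrArg Subtype.val (e.injective (Subtype.ext hxy))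
    · intro y hy
      refine ⟨e.symm ⟨y, hy⟩, (e.symm _).2, ?_⟩
      rw [hf, e.apply_symm_apply]
    · obtain ⟨δ, hδ, h⟩ := h ε hε
      refine ⟨δ, hδ, fun x hx y hy h₁ h₂ => ?_⟩
      rw [hf ⟨x, hx⟩, hf ⟨y, hy⟩]
      exact h ⟨x, hx⟩ ⟨y, hy⟩ h₁ h₂

theorem map_exp_neg_atTop :
    map (fun u : ℝ => Real.exp (-u)) atTop = nhdsWithin (0 : ℝ) (Set.Ioi 0) := by
  rw [← Real.map_exp_atBot, ← map_neg_atTop, map_map]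
  rfl

theorem EquivNearZero.tendsto_sub {g h : ℝ → ℝ} (H : EquivNearZero g h) :
    Tendsto (fun u => h (Real.exp (-u)) - g (Real.exp (-u))) atTop (nhds 0) := by
  obtain ⟨C, -, δ, hδ, H⟩ := H
  have hlim : Tendsto (fun u : ℝ => Real.exp (-u)) atTop (nhds 0) :=
    Real.tendsto_exp_atBot.comp tendsto_neg_atTop_atBot
  refine squeeze_zero_norm' ?_ (tendsto_const_nhds (x := C) |>.div_atTop tendsto_id)
  filter_upwards [hlim.eventually_lt_const hδ, eventually_ge_atTop 0] with u h₁ h₂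
  simpa [abs_of_nonneg h₂] using H _ (Real.exp_pos _) h₁

theorem LinearGrowth.eventually_div_mem {ψ : ℝ → ℝ} {u₀ p q b : ℝ} (H : LinearGrowth ψ u₀ p q b) :
    ∀ᶠ u in atTop, p / 2 ≤ ψ u / u ∧ ψ u / u ≤ q + 1 := by
  have hp : Tendsto (fun u : ℝ => p / 2 * u) atTop atTop :=
    tendsto_id.const_mul_atTop (half_pos H.p_pos)
  filter_upwards [eventually_gt_atTop 0, eventually_ge_atTop u₀,
    hp.eventually_ge_atTop (p * u₀ + b), eventually_ge_atTop (b - q * u₀)] with u h₁ h₂ h₃ h₄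
  have h₅ := H.lower u₀ u le_rfl h₂
  have h₆ := H.upper u₀ u h₂
  rw [H.zero] at h₅ h₆
  rw [le_div_iff₀ h₁, div_le_iff₀ h₁]
  constructor <;> linarith

theorem tendsto_div_one_iff {ι : Type*} {l : Filter ι} {f g : ι → ℝ} {c C : ℝ} (hc : 0 < c)
    (hg : ∀ᶠ i in l, c ≤ g i ∧ g i ≤ C) :
    Tendsto (fun i => f i / g i) l (nhds 1) ↔ Tendsto (fun i => f i - g i) l (nhds 0) := by
  rw [← tendsto_sub_nhds_zero_iff]
  constructor <;> intro h
  · refine squeeze_zero_norm' ?_ (by simpa using h.norm.mul_const C)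
    filter_upwards [hg] with i hi
    have hpos := hc.trans_le hi.1
    rw [show f i - g i = (f i / g i - 1) * g i by field_simp, norm_mul,
      Real.norm_of_nonneg hpos.le]
    exact mul_le_mul_of_nonneg_left hi.2 (norm_nonneg _)
  · refine squeeze_zero_norm' ?_ (by simpa using h.norm.div_const c)
    filter_upwards [hg] with i hi
    have hpos := hc.trans_le hi.1
    rw [show f i / g i - 1 = (f i - g i) / g i by field_simp, norm_div,
      Real.norm_of_nonneg hpos.le]
    exact div_le_div_of_nonneg_left (norm_nonneg _) hc hi.1

theorem limsup_abs_log_div_eq_zero_iff {ι : Type*} {l : Filter ι} [l.NeBot] {f g : ι → ℝ}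
    {c C c' C' : ℝ} (hc : 0 < c) (hc' : 0 < c') (hf : ∀ᶠ i in l, c ≤ f i ∧ f i ≤ C)
    (hg : ∀ᶠ i in l, c' ≤ g i ∧ g i ≤ C') :
    limsup (fun i => |Real.log (f i / g i)|) l = 0 ↔
      Tendsto (fun i => f i / g i) l (nhds 1) := by
  constructor <;> intro h
  · have hbdd : l.IsBoundedUnder (· ≤ ·) fun i => |Real.log (f i / g i)| := by
      refine isBoundedUnder_of_eventually_le
        (a := |Real.log c - Real.log C'| + |Real.log C - Real.log c'|) ?_
      filter_upwards [hf, hg] with i hi hi'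
      have hfi := hc.trans_le hi.1
      have hgi := hc'.trans_le hi'.1
      rw [Real.log_div hfi.ne' hgi.ne']
      have h₁ := Real.log_le_log hc hi.1
      have h₂ := Real.log_le_log hfi hi.2
      have h₃ := Real.log_le_log hc' hi'.1
      have h₄ := Real.log_le_log hgi hi'.2
      rw [abs_le]
      constructor
      · linarith [neg_abs_le (Real.log c - Real.log C'), abs_nonneg (Real.log C - Real.log c')]
      · linarith [le_abs_self (Real.log C - Real.log c'), abs_nonneg (Real.log c - Real.log C')]
    have hbdd' : l.IsBoundedUnder (· ≥ ·) fun i => |Real.log (f i / g i)| :=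
      isBoundedUnder_of ⟨0, fun i => abs_nonneg _⟩
    have hlim : Tendsto (fun i => |Real.log (f i / g i)|) l (nhds 0) :=
      tendsto_of_le_liminf_of_limsup_le
        (le_liminf_of_le hbdd.isCoboundedUnder_ge (Eventually.of_forall fun i => abs_nonneg _))
        h.le hbdd hbdd'
    have hexp := (Real.continuous_exp.tendsto 0).comp
      (tendsto_zero_iff_abs_tendsto_zero _ |>.2 hlim)
    rw [Real.exp_zero] at hexp
    refine hexp.congr' ?_
    filter_upwards [hf, hg] with i hi hi'
    exact Real.exp_log (div_pos (hc.trans_le hi.1) (hc'.trans_le hi'.1))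
  · have hlog := (h.log one_ne_zero).abs
    rw [Real.log_one, abs_zero] at hlog
    exact hlog.limsup_eq

theorem IsAlphaRep.exists_logGrowth {X : Type*} [MetricSpace X] [MeasurableSpace X] {A : Set X}
    {μ : Measure X} {lam kappa del Del : ℝ} {g : ℝ → ℝ} (hg : IsAlphaRep A μ g)
    (h : IsHomog A μ lam kappa del Del) :
    ∃ x ∈ A, Tendsto (fun u => logGrowth μ x u / u - g (Real.exp (-u))) atTop (nhds 0) ∧
      ∃ c C : ℝ, 0 < c ∧ ∀ᶠ u in atTop, c ≤ g (Real.exp (-u)) ∧ g (Real.exp (-u)) ≤ C := by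
  obtain ⟨x, hx, hg⟩ := hg
  have hlim := hg.tendsto_sub
  simp only [alphaPt_exp_neg] at hlim
  obtain ⟨p, q, b, H⟩ := h.linearGrowth hx
  refine ⟨x, hx, hlim, p / 4, q + 1 + p / 4, by linarith [H.p_pos], ?_⟩
  filter_upwards [H.eventually_div_mem,
    hlim.eventually (Ioo_mem_nhds (show -(p / 4) < 0 by linarith [H.p_pos])
      (show 0 < p / 4 by linarith [H.p_pos]))] with u h₁ h₂
  constructor <;> linarith [h₁.1, h₁.2, h₂.1, h₂.2]

/-- Two uniformly disconnected homogeneous sets are quasi-Lipschitz equivalent if and only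
if `χ(A,B) = 0`, i.e. if and only if `lim_{r→0} α_A(r)/α_B(r) = 1`. -/
theorem statement17 {X Y : Type*} [MetricSpace X] [MeasurableSpace X] [BorelSpace X]
    [MetricSpace Y] [MeasurableSpace Y] [BorelSpace Y]
    (A : Set X) (B : Set Y) (μ : Measure X) (ν : Measure Y)
    (lamA kapA delA DelA lamB kapB delB DelB : ℝ)
    (hA : IsHomog A μ lamA kapA delA DelA) (hB : IsHomog B ν lamB kapB delB DelB)
    (hudA : UnifDisconn A) (hudB : UnifDisconn B)
    (gA gB : ℝ → ℝ) (hgA : IsAlphaRep A μ gA) (hgB : IsAlphaRep B ν gB) :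
    (QuasiLipEquiv A B ↔ chiFun gA gB = 0) ∧
      (chiFun gA gB = 0 ↔
        Filter.Tendsto (fun r => gA r / gB r) (nhdsWithin (0 : ℝ) (Set.Ioi 0)) (nhds 1)) := by
  obtain ⟨x, hx, hxlim, c, C, hc, hgA⟩ := hgA.exists_logGrowth hA
  obtain ⟨y, hy, hylim, c', C', hc', hgB⟩ := hgB.exists_logGrowth hB
  have hchi : chiFun gA gB = 0 ↔
      Tendsto (fun r => gA r / gB r) (nhdsWithin (0 : ℝ) (Set.Ioi 0)) (nhds 1) :=
    limsup_abs_log_div_eq_zero_iff hc hc'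
      (map_exp_neg_atTop ▸ hgA : ∀ᶠ r in nhdsWithin (0 : ℝ) (Set.Ioi 0), c ≤ gA r ∧ gA r ≤ C)
      (map_exp_neg_atTop ▸ hgB : ∀ᶠ r in nhdsWithin (0 : ℝ) (Set.Ioi 0), c' ≤ gB r ∧ gB r ≤ C')
  refine ⟨?_, hchi⟩
  have hlim : Tendsto (fun r => gA r / gB r) (nhdsWithin (0 : ℝ) (Set.Ioi 0)) (nhds 1) ↔
      (fun u => logGrowth μ x u - logGrowth ν y u) =o[atTop] fun u => u := by
    rw [← map_exp_neg_atTop, tendsto_map'_iff,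
      Asymptotics.isLittleO_iff_tendsto' ((eventually_ne_atTop 0).mono fun u hu h => absurd h hu)]
    refine (tendsto_div_one_iff hc' hgB).trans ⟨fun h => ?_, fun h => ?_⟩
    · simpa using (h.add (hxlim.sub hylim)).congr fun u => by ring
    · simpa using (h.sub (hxlim.sub hylim)).congr fun u => by ring
  have := isCompact_iff_compactSpace.1 hA.compact
  have := isCompact_iff_compactSpace.1 hB.compact
  have : Nonempty A := ⟨x, hx⟩
  have : Nonempty B := ⟨y, hy⟩
  obtain ⟨p, q, b, H⟩ := hA.linearGrowth hx
  obtain ⟨p', q', b', H'⟩ := hB.linearGrowth hy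
  obtain ⟨R, K, h⟩ := hA.isCellSpace hudA hx
  obtain ⟨R', K', h'⟩ := hB.isCellSpace hudB hy
  rw [hchi, hlim, quasiLipEquiv_iff ⟨y, hy⟩]
  exact ⟨fun ⟨_, he⟩ => h.isLittleO_of_quasiLip H h' H' he, h.exists_quasiLip_equiv H h' H'⟩

end
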